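/- Let A, B, C be ℚ-vector spaces and let d₂ : B → A and d₁ : A → C be ℚ-linear maps with d₁ ∘ d₂ = 0. Equip Aℝ = ℝ ⊗_ℚ A with a norm ‖·‖ making it a normed real vector space, and let d₂ℝ : Bℝ → Aℝ and d₁ℝ : Aℝ → Cℝ be the ℝ-linear scalar extensions. Let a ∈ ker(d₁ℝ) be such that there exists a₀ ∈ ker(d₁) with a − ι_A(a₀) ∈ im(d₂ℝ). Then for every ε > 0 there exists a′ ∈ ker(d₁) such that a − ι_A(a′) ∈ im(d₂ℝ) and ‖a − ι_A(a′)‖ ≤ ε. -/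

import Mathlib

open TensorProduct

/-- Every vector of the scalar extension `ℝ ⊗[ℚ] V` can be approximated by rational vectors
with respect to any seminorm. -/
theorem Seminorm.exists_one_tmul_sub_lt {V : Type*} [AddCommGroup V] [Module ℚ V]
    (p : Seminorm ℝ (ℝ ⊗[ℚ] V)) (x : ℝ ⊗[ℚ] V) {ε : ℝ} (hε : 0 < ε) :
    ∃ v : V, p (x - (1 : ℝ) ⊗ₜ[ℚ] v) < ε := by
  induction x using TensorProduct.induction_on generalizing ε with
  | zero => exact ⟨0, by simpa using hε⟩
  | tmul r v =>
    have hM : 0 < p ((1 : ℝ) ⊗ₜ[ℚ] v) + 1 := by positivity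
    obtain ⟨q, hrq, hqr⟩ := exists_rat_btwn
      (show r < r + ε / (p ((1 : ℝ) ⊗ₜ[ℚ] v) + 1) from lt_add_of_pos_right r (by positivity))
    refine ⟨q • v, ?_⟩
    have h : r ⊗ₜ[ℚ] v - (1 : ℝ) ⊗ₜ[ℚ] (q • v) = (r - q) • ((1 : ℝ) ⊗ₜ[ℚ] v) := by
      rw [← TensorProduct.smul_tmul, ← TensorProduct.sub_tmul, TensorProduct.smul_tmul',
        smul_eq_mul, mul_one, Rat.smul_def, mul_one]
    rw [h, map_smul_eq_mul, Real.norm_eq_abs, abs_sub_comm, abs_of_pos (sub_pos.2 hrq)]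
    calc (q - r) * p ((1 : ℝ) ⊗ₜ[ℚ] v)
        ≤ (q - r) * (p ((1 : ℝ) ⊗ₜ[ℚ] v) + 1) := by
          gcongr
          linarith
      _ < ε := (lt_div_iff₀ hM).1 (sub_lt_iff_lt_add'.2 hqr)
  | add x y hx hy =>
    obtain ⟨v, hv⟩ := hx (half_pos hε)
    obtain ⟨w, hw⟩ := hy (half_pos hε)
    refine ⟨v + w, ?_⟩
    rw [TensorProduct.tmul_add, add_sub_add_comm]
    linarith [map_add_le_add p (x - (1 : ℝ) ⊗ₜ[ℚ] v) (y - (1 : ℝ) ⊗ₜ[ℚ] w)]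

/-- Rational approximation in homology: given a chain-complex fragment
`B --d₂--> A --d₁--> C` of `ℚ`-vector spaces with `d₁ ∘ d₂ = 0`, a norm `N` on the
scalar extension `ℝ ⊗[ℚ] A` (a seminorm with definiteness), and a real cycle
`a ∈ ker(d₁ℝ)` which is homologous (via `im(d₂ℝ)`) to a rational cycle `ι(a₀)`,
then for every `ε > 0` there is a rational cycle `a'` homologous to `a` with
`N(a − ι(a')) ≤ ε`. -/
theorem stmt6 (A B C : Type) [AddCommGroup A] [Module ℚ A] [AddCommGroup B] [Module ℚ B]
    [AddCommGroup C] [Module ℚ C]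
    (d₂ : B →ₗ[ℚ] A) (d₁ : A →ₗ[ℚ] C) (hd : d₁ ∘ₗ d₂ = 0)
    (N : Seminorm ℝ (ℝ ⊗[ℚ] A)) (hN : ∀ x, N x = 0 → x = 0)
    (a : ℝ ⊗[ℚ] A) (ha : LinearMap.baseChange ℝ d₁ a = 0)
    (a₀ : A) (ha₀ : d₁ a₀ = 0)
    (hhom : a - (1 : ℝ) ⊗ₜ[ℚ] a₀ ∈ LinearMap.range (LinearMap.baseChange ℝ d₂)) :
    ∀ ε : ℝ, 0 < ε →
      ∃ a' : A, d₁ a' = 0 ∧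
        a - (1 : ℝ) ⊗ₜ[ℚ] a' ∈ LinearMap.range (LinearMap.baseChange ℝ d₂) ∧
        N (a - (1 : ℝ) ⊗ₜ[ℚ] a') ≤ ε := by
  intro ε hε
  obtain ⟨x, hx⟩ := hhom
  obtain ⟨b, hb⟩ := (N.comp (LinearMap.baseChange ℝ d₂)).exists_one_tmul_sub_lt x hε
  have h : LinearMap.baseChange ℝ d₂ (x - (1 : ℝ) ⊗ₜ[ℚ] b) =
      a - (1 : ℝ) ⊗ₜ[ℚ] (a₀ + d₂ b) := by
    rw [map_sub, hx, LinearMap.baseChange_tmul, TensorProduct.tmul_add, sub_sub]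
  refine ⟨a₀ + d₂ b, ?_, ⟨_, h⟩, ?_⟩
  · rw [map_add, ha₀, ← LinearMap.comp_apply, hd, LinearMap.zero_apply, add_zero]
  · rw [← h]
    exact hb.le
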